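/- The function ε₂(τ) = (1/16)θ₁(0,τ)⁴ θ₃(0,τ)⁴ is a modular form of weight 4 over Γ⁰(2) with trivial character: it is holomorphic on the upper half-plane ℍ, satisfies ε₂((aτ+b)/(cτ+d)) = (cτ+d)⁴ ε₂(τ) for every matrix (a b; c d) ∈ Γ⁰(2) and τ ∈ ℍ, and for every γ ∈ SL₂(ℤ) the weight-4 slash translate of ε₂ by γ is bounded as Im τ → ∞. -/

import Mathlib

open Complex

noncomputable section

/-- `q^s = e^{2πisτ}`. -/
def qpow (s τ : ℂ) : ℂ := Complex.exp (2 * (Real.pi : ℂ) * Complex.I * s * τ)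

/-- The Jacobi theta function `θ(v, τ)`, defined by its infinite product. -/
def jTheta (v τ : ℂ) : ℂ :=
  2 * qpow (1/8) τ * Complex.sin ((Real.pi : ℂ) * v) *
    ∏' j : ℕ, ((1 - qpow ((j : ℂ) + 1) τ)
      * (1 - Complex.exp (2 * (Real.pi : ℂ) * Complex.I * v) * qpow ((j : ℂ) + 1) τ)
      * (1 - Complex.exp (-(2 * (Real.pi : ℂ) * Complex.I * v)) * qpow ((j : ℂ) + 1) τ))

/-- The Jacobi theta function `θ₁(v, τ)`, defined by its infinite product. -/
def jTheta1 (v τ : ℂ) : ℂ :=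
  2 * qpow (1/8) τ * Complex.cos ((Real.pi : ℂ) * v) *
    ∏' j : ℕ, ((1 - qpow ((j : ℂ) + 1) τ)
      * (1 + Complex.exp (2 * (Real.pi : ℂ) * Complex.I * v) * qpow ((j : ℂ) + 1) τ)
      * (1 + Complex.exp (-(2 * (Real.pi : ℂ) * Complex.I * v)) * qpow ((j : ℂ) + 1) τ))

/-- The Jacobi theta function `θ₂(v, τ)`, defined by its infinite product
(the `j`-th factor involves `q^{j+1-1/2}`). -/
def jTheta2 (v τ : ℂ) : ℂ :=
  ∏' j : ℕ, ((1 - qpow ((j : ℂ) + 1) τ)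
    * (1 - Complex.exp (2 * (Real.pi : ℂ) * Complex.I * v) * qpow ((j : ℂ) + 1/2) τ)
    * (1 - Complex.exp (-(2 * (Real.pi : ℂ) * Complex.I * v)) * qpow ((j : ℂ) + 1/2) τ))

/-- The Jacobi theta function `θ₃(v, τ)`, defined by its infinite product. -/
def jTheta3 (v τ : ℂ) : ℂ :=
  ∏' j : ℕ, ((1 - qpow ((j : ℂ) + 1) τ)
    * (1 + Complex.exp (2 * (Real.pi : ℂ) * Complex.I * v) * qpow ((j : ℂ) + 1/2) τ)
    * (1 + Complex.exp (-(2 * (Real.pi : ℂ) * Complex.I * v)) * qpow ((j : ℂ) + 1/2) τ))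

/-- `θ'(0, τ)`: the partial derivative of `θ(v, τ)` in `v`, evaluated at `v = 0`. -/
def jThetaDeriv (τ : ℂ) : ℂ := deriv (fun v => jTheta v τ) 0

/-- `ε₂(τ) = (1/16)θ₁(0,τ)⁴θ₃(0,τ)⁴`. -/
def epsilon2 (τ : ℂ) : ℂ := (1/16) * (jTheta1 0 τ ^ 4 * jTheta3 0 τ ^ 4)

section

open UpperHalfPlane hiding I
open ModularForm Filter Topology
open scoped MatrixGroups

/-- The Euler product `∏_{n ≥ 1} (1 - q^n)`. -/
def eulerProd (q : ℂ) : ℂ := ∏' n : ℕ, (1 - q ^ (n + 1))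

lemma eulerProd_ne_zero {q : ℂ} (hq : ‖q‖ < 1) : eulerProd q ≠ 0 := by
  have h := tprod_one_add_ne_zero_of_summable (f := fun n : ℕ ↦ -q ^ (n + 1)) (fun n h ↦ ?_) ?_
  · simpa [eulerProd, sub_eq_add_neg] using h
  · have h1 : q ^ (n + 1) = 1 := by linear_combination -h
    have h2 : ‖q‖ ^ (n + 1) < 1 := pow_lt_one₀ (norm_nonneg _) hq n.succ_ne_zero
    rw [← norm_pow, h1, norm_one] at h2
    exact lt_irrefl _ h2
  · simpa using (summable_nat_add_iff 1).mpr (summable_geometric_of_lt_one (norm_nonneg _) hq)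

lemma continuousAt_eulerProd_zero : ContinuousAt eulerProd 0 :=
  (differentiableOn_tprod_one_sub_pow.differentiableAt
    (Metric.ball_mem_nhds 0 one_pos)).continuousAt

lemma eulerProd_zero : eulerProd 0 = 1 := by
  simp [eulerProd]

lemma multipliable_one_add_pow {q : ℂ} (hq : ‖q‖ < 1) :
    Multipliable fun n : ℕ ↦ 1 + q ^ (n + 1) := by
  apply multipliable_one_add_of_summable
  simpa using (summable_nat_add_iff 1).mpr (summable_geometric_of_lt_one (norm_nonneg _) hq)

lemma multipliable_one_add_pow_odd {q : ℂ} (hq : ‖q‖ < 1) :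
    Multipliable fun n : ℕ ↦ 1 + q ^ (2 * n + 1) := by
  apply multipliable_one_add_of_summable
  simpa [Function.comp_def] using
    (summable_geometric_of_lt_one (norm_nonneg _) hq).comp_injective
      (i := fun n : ℕ ↦ 2 * n + 1) (fun a b h ↦ by simpa using h)

lemma norm_sq_lt_one {q : ℂ} (hq : ‖q‖ < 1) : ‖q ^ 2‖ < 1 := by
  rw [norm_pow]
  exact pow_lt_one₀ (norm_nonneg _) hq two_ne_zero

lemma tprod_odd_mul_even_mul_eulerProd {q : ℂ} (hq : ‖q‖ < 1) :
    (∏' n : ℕ, (1 + q ^ (2 * n + 1))) * (∏' n : ℕ, (1 + (q ^ 2) ^ (n + 1))) * eulerProd q =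
      eulerProd (q ^ 2) := by
  have hodd : Multipliable fun n : ℕ ↦ 1 + q ^ (2 * n + 1 + 1) :=
    (multipliable_one_add_pow (norm_sq_lt_one hq)).congr fun n ↦ by ring_nf
  have h := tprod_even_mul_odd (f := fun n : ℕ ↦ 1 + q ^ (n + 1))
    (multipliable_one_add_pow_odd hq) hodd
  rw [tprod_congr (f := fun n : ℕ ↦ 1 + (q ^ 2) ^ (n + 1))
    (g := fun n : ℕ ↦ 1 + q ^ (2 * n + 1 + 1)) (fun n ↦ by ring), h,
    eulerProd, ← (multipliable_one_add_pow hq).tprod_mul (multipliable_one_sub_pow hq), eulerProd]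
  exact tprod_congr fun n ↦ by ring

lemma tprod_mul_mul {f g : ℕ → ℂ} (hf : Multipliable f) (hg : Multipliable g) :
    ∏' n, f n * g n * g n = (∏' n, f n) * (∏' n, g n) * ∏' n, g n := by
  rw [(hf.mul hg).tprod_mul hg, hf.tprod_mul hg]

/-- The nome `e^{πiτ}`. -/
def nome (τ : ℂ) : ℂ := cexp (Real.pi * I * τ)

lemma norm_nome (τ : ℂ) : ‖nome τ‖ = Real.exp (-(Real.pi * τ.im)) := by
  simp [nome, Complex.norm_exp]

lemma norm_nome_lt_one {τ : ℂ} (hτ : 0 < τ.im) : ‖nome τ‖ < 1 := by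
  rw [norm_nome, Real.exp_lt_one_iff]
  have := mul_pos Real.pi_pos hτ
  linarith

lemma nome_pow (τ : ℂ) (n : ℕ) : nome τ ^ n = cexp (Real.pi * I * n * τ) := by
  rw [nome, ← Complex.exp_nat_mul]
  ring_nf

lemma nome_two_mul (τ : ℂ) : nome (2 * τ) = nome τ ^ 2 := by
  rw [nome_pow, nome]
  push_cast
  ring_nf

lemma nome_add_two (τ : ℂ) : nome (τ + 2) = nome τ := by
  rw [nome, nome, ← Complex.exp_periodic (Real.pi * I * τ)]
  ring_nf

lemma qpow_nat_add_one (n : ℕ) (τ : ℂ) : qpow (n + 1) τ = (nome τ ^ 2) ^ (n + 1) := by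
  rw [← pow_mul, nome_pow, qpow]
  push_cast
  ring_nf

lemma qpow_nat_add_half (n : ℕ) (τ : ℂ) : qpow (n + 1 / 2) τ = nome τ ^ (2 * n + 1) := by
  rw [nome_pow, qpow]
  push_cast
  ring_nf

lemma qpow_eighth_pow_four (τ : ℂ) : qpow (1 / 8) τ ^ 4 = nome τ := by
  rw [qpow, nome, ← Complex.exp_nat_mul]
  push_cast
  ring_nf

lemma jTheta1_zero_eq {τ : ℂ} (hτ : 0 < τ.im) :
    jTheta1 0 τ = 2 * qpow (1 / 8) τ * (eulerProd (nome τ ^ 2) *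
      (∏' n : ℕ, (1 + (nome τ ^ 2) ^ (n + 1))) * ∏' n : ℕ, (1 + (nome τ ^ 2) ^ (n + 1))) := by
  have hq := norm_sq_lt_one (norm_nome_lt_one hτ)
  rw [jTheta1, eulerProd, ← tprod_mul_mul (multipliable_one_sub_pow hq)
    (multipliable_one_add_pow hq)]
  simp [qpow_nat_add_one]

lemma jTheta3_zero_eq {τ : ℂ} (hτ : 0 < τ.im) :
    jTheta3 0 τ = eulerProd (nome τ ^ 2) *
      (∏' n : ℕ, (1 + nome τ ^ (2 * n + 1))) * ∏' n : ℕ, (1 + nome τ ^ (2 * n + 1)) := by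
  have hq := norm_nome_lt_one hτ
  rw [jTheta3, eulerProd, ← tprod_mul_mul (multipliable_one_sub_pow (norm_sq_lt_one hq))
    (multipliable_one_add_pow_odd hq)]
  simp only [qpow_nat_add_one, qpow_nat_add_half]
  simp

lemma epsilon2_eq_eulerProd {τ : ℂ} (hτ : 0 < τ.im) :
    epsilon2 τ = nome τ * eulerProd (nome τ ^ 2) ^ 16 / eulerProd (nome τ) ^ 8 := by
  have hq := norm_nome_lt_one hτ
  have h := tprod_odd_mul_even_mul_eulerProd hq
  rw [eq_div_iff (pow_ne_zero _ (eulerProd_ne_zero hq)), epsilon2, jTheta1_zero_eq hτ,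
    jTheta3_zero_eq hτ]
  set b := ∏' n : ℕ, (1 + nome τ ^ (2 * n + 1))
  set c := ∏' n : ℕ, (1 + (nome τ ^ 2) ^ (n + 1))
  calc _ = qpow (1 / 8) τ ^ 4 * eulerProd (nome τ ^ 2) ^ 8 * (b * c * eulerProd (nome τ)) ^ 8 := by
        ring
    _ = _ := by rw [h, qpow_eighth_pow_four]; ring

lemma eta_eq_eulerProd (τ : ℂ) : η τ = cexp (2 * Real.pi * I * τ / 24) *
    eulerProd (nome τ ^ 2) := by
  rw [ModularForm.eta, eulerProd]
  congr 1
  refine tprod_congr fun n ↦ ?_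
  rw [eta_q_eq_pow, nome_pow]
  push_cast
  ring_nf

lemma epsilon2_eq_eta {τ : ℂ} (hτ : 0 < τ.im) :
    epsilon2 τ = η τ ^ 16 / η (τ / 2) ^ 8 := by
  have h2 : nome (τ / 2) ^ 2 = nome τ := by rw [← nome_two_mul]; ring_nf
  have h3 : nome τ = cexp (2 * Real.pi * I * τ / 24) ^ 16 /
      cexp (2 * Real.pi * I * (τ / 2) / 24) ^ 8 := by
    rw [← Complex.exp_nat_mul, ← Complex.exp_nat_mul, ← Complex.exp_sub, nome]
    push_cast
    ring_nf
  rw [epsilon2_eq_eulerProd hτ, eta_eq_eulerProd, eta_eq_eulerProd, h2, mul_pow, mul_pow,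
    mul_div_mul_comm, ← h3, mul_div_assoc]

lemma eta_neg_inv_pow_eight {τ : ℂ} (hτ : 0 < τ.im) : η (-1 / τ) ^ 8 = τ ^ 4 * η τ ^ 8 := by
  have hsqrt {z : ℂ} (hz : z ≠ 0) : sqrt z ^ 8 = z ^ 4 := by
    rw [sqrt_eq_exp hz, ← Complex.exp_nat_mul]
    conv_rhs => rw [← Complex.exp_log hz, ← Complex.exp_nat_mul]
    push_cast
    ring_nf
  have hτ0 : τ ≠ 0 := fun h ↦ by simp [h] at hτ
  have h : η (-1 / τ) = (sqrt I)⁻¹ * (sqrt τ * η τ) := by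
    simpa using eta_comp_eq_csqrt_I_inv hτ
  rw [h, mul_pow, mul_pow, inv_pow, hsqrt I_ne_zero, hsqrt hτ0, I_pow_four, inv_one, one_mul]

lemma epsilon2_neg_inv {τ : ℂ} (hτ : 0 < τ.im) : epsilon2 (-1 / τ) = τ ^ 4 *
    (eulerProd (nome τ ^ 2) ^ 16 / eulerProd ((nome τ ^ 2) ^ 2) ^ 8 / 16) := by
  have hτ0 : τ ≠ 0 := fun h ↦ by simp [h] at hτ
  have him : 0 < (-1 / τ).im := by
    have := im_inv_neg_coe_pos ⟨τ, hτ⟩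
    simpa [neg_div, inv_neg] using this
  have h2 : 0 < (2 * τ).im := by simpa using hτ
  have hq : ‖(nome τ ^ 2) ^ 2‖ < 1 := norm_sq_lt_one (norm_sq_lt_one (norm_nome_lt_one hτ))
  have e1 : -1 / τ / 2 = -1 / (2 * τ) := by field_simp
  have e2 : cexp (2 * Real.pi * I * (2 * τ) / 24) ^ 8 = cexp (2 * Real.pi * I * τ / 24) ^ 16 := by
    rw [← Complex.exp_nat_mul, ← Complex.exp_nat_mul]
    push_cast
    ring_nf
  rw [epsilon2_eq_eta him, e1, eta_neg_inv_pow_eight h2,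
    show η (-1 / τ) ^ 16 = (η (-1 / τ) ^ 8) ^ 2 by ring, eta_neg_inv_pow_eight hτ,
    eta_eq_eulerProd (2 * τ), eta_eq_eulerProd τ, nome_two_mul, mul_pow _ (eulerProd _),
    mul_pow _ (eulerProd _), e2]
  have := eulerProd_ne_zero hq
  have := Complex.exp_ne_zero (2 * Real.pi * I * τ / 24)
  field_simp
  ring

lemma differentiableOn_epsilon2 : DifferentiableOn ℂ epsilon2 {τ : ℂ | 0 < τ.im} := by
  have h : DifferentiableOn ℂ (fun τ ↦ η τ ^ 16 / η (τ / 2) ^ 8) {τ : ℂ | 0 < τ.im} := by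
    intro τ hτ
    have h2 : 0 < (τ / 2).im := by simpa using hτ
    refine (DifferentiableAt.div
      ((differentiableAt_eta_of_mem_upperHalfPlaneSet hτ).pow 16)
      (DifferentiableAt.pow ?_ 8) (pow_ne_zero _ (eta_ne_zero (z := τ / 2) h2))).differentiableWithinAt
    exact DifferentiableAt.comp (f := fun τ ↦ τ / 2) τ
      (differentiableAt_eta_of_mem_upperHalfPlaneSet h2) (by fun_prop)
  exact h.congr fun τ hτ ↦ epsilon2_eq_eta hτ

/-- The restriction of `ε₂` to the upper half-plane. -/
def epsilon2UHP (τ : ℍ) : ℂ := epsilon2 τ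

lemma epsilon2UHP_slash_apply (γ : SL(2, ℤ)) (τ : ℍ) :
    (epsilon2UHP ∣[(4 : ℤ)] γ) τ = (((γ 1 0 : ℂ) * τ + (γ 1 1 : ℂ)) ^ 4)⁻¹ *
      epsilon2 (((γ 0 0 : ℂ) * τ + (γ 0 1 : ℂ)) / ((γ 1 0 : ℂ) * τ + (γ 1 1 : ℂ))) := by
  rw [SL_slash_apply, epsilon2UHP, coe_specialLinearGroup_apply, ModularGroup.denom_apply, zpow_neg,
    mul_comm]
  simp [zpow_ofNat]

lemma epsilon2UHP_slash_S_apply (τ : ℍ) : (epsilon2UHP ∣[(4 : ℤ)] ModularGroup.S) τ =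
    eulerProd (nome τ ^ 2) ^ 16 / eulerProd ((nome τ ^ 2) ^ 2) ^ 8 / 16 := by
  have h := epsilon2_neg_inv τ.im_pos
  have hτ := τ.ne_zero
  rw [epsilon2UHP_slash_apply]
  simp only [ModularGroup.S, Matrix.of_apply, Matrix.cons_val_zero, Matrix.cons_val_one]
  simp [h]
  field_simp

lemma slash_T_apply (f : ℍ → ℂ) (τ : ℍ) :
    (f ∣[(4 : ℤ)] ModularGroup.T) τ = f ((1 : ℝ) +ᵥ τ) := by
  rw [SL_slash_apply, modular_T_smul, ModularGroup.denom_apply]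
  simp [ModularGroup.T]

lemma epsilon2UHP_slash_T_slash_T :
    (epsilon2UHP ∣[(4 : ℤ)] ModularGroup.T) ∣[(4 : ℤ)] ModularGroup.T = epsilon2UHP := by
  ext τ
  have h2 : ((1 : ℝ) : ℂ) + (((1 : ℝ) : ℂ) + τ) = τ + 2 := by push_cast; ring
  have h0 : 0 < ((τ : ℂ) + 2).im := by simpa using τ.im_pos
  rw [slash_T_apply, slash_T_apply, epsilon2UHP, epsilon2UHP, coe_vadd, coe_vadd, h2,
    epsilon2_eq_eulerProd h0, epsilon2_eq_eulerProd τ.im_pos, nome_add_two]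

lemma epsilon2UHP_slash_S_slash_T :
    (epsilon2UHP ∣[(4 : ℤ)] ModularGroup.S) ∣[(4 : ℤ)] ModularGroup.T =
      epsilon2UHP ∣[(4 : ℤ)] ModularGroup.S := by
  ext τ
  have h : nome ((1 : ℝ) + τ : ℂ) ^ 2 = nome τ ^ 2 := by
    rw [← nome_two_mul, ← nome_two_mul, ← nome_add_two (2 * τ)]
    push_cast
    ring_nf
  rw [slash_T_apply, epsilon2UHP_slash_S_apply, epsilon2UHP_slash_S_apply, coe_vadd, h]

lemma epsilon2UHP_slash_S_slash_S :
    (epsilon2UHP ∣[(4 : ℤ)] ModularGroup.S) ∣[(4 : ℤ)] ModularGroup.S = epsilon2UHP := by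
  rw [← SlashAction.slash_mul]
  ext τ
  rw [epsilon2UHP_slash_apply, Matrix.SpecialLinearGroup.coe_mul, ModularGroup.S_mul_S_eq]
  simp [epsilon2UHP, show (-1 : ℂ) ^ 4 = 1 by norm_num]

lemma eq_slash_inv {f g : ℍ → ℂ} {γ : SL(2, ℤ)} (h : f ∣[(4 : ℤ)] γ = g) :
    g ∣[(4 : ℤ)] γ⁻¹ = f := by
  rw [← h, ← SlashAction.slash_mul, mul_inv_cancel, SlashAction.slash_one]

lemma epsilon2UHP_slash_T_slash_S :
    (epsilon2UHP ∣[(4 : ℤ)] ModularGroup.T) ∣[(4 : ℤ)] ModularGroup.S =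
      epsilon2UHP ∣[(4 : ℤ)] ModularGroup.T := by
  have h := congrArg (epsilon2UHP ∣[(4 : ℤ)] ·) ModularGroup.T_S_rel
  simp only [smul_eq_mul, SlashAction.slash_mul, epsilon2UHP_slash_S_slash_S, epsilon2UHP_slash_S_slash_T,
    eq_slash_inv epsilon2UHP_slash_T_slash_T] at h
  exact h

/-- The weight 4 slash translates of `ε₂` depend only on the top row modulo 2. -/
lemma epsilon2UHP_slash (γ : SL(2, ℤ)) :
    (Even (γ 0 1) → epsilon2UHP ∣[(4 : ℤ)] γ = epsilon2UHP) ∧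
    (Even (γ 0 0) → epsilon2UHP ∣[(4 : ℤ)] γ = epsilon2UHP ∣[(4 : ℤ)] ModularGroup.S) ∧
    (Odd (γ 0 0) → Odd (γ 0 1) →
      epsilon2UHP ∣[(4 : ℤ)] γ = epsilon2UHP ∣[(4 : ℤ)] ModularGroup.T) := by
  have hγ : γ ∈ Subgroup.closure {ModularGroup.S, ModularGroup.T} := by
    rw [SpecialLinearGroup.SL2Z_generators]
    trivial
  have hdet (x : SL(2, ℤ)) : ¬ (Even (x 0 0) ∧ Even (x 0 1)) := by
    rintro ⟨h0, h1⟩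
    have h := Matrix.det_fin_two x.1
    rw [x.2] at h
    exact Int.not_even_one (h ▸ (h0.mul_right _).sub (h1.mul_right _))
  induction hγ using Subgroup.closure_induction_right with
  | one => simp
  | mul_right x hx y hy ih =>
    have hx := hdet x
    rcases hy with rfl | rfl
    · have h0 : (x * ModularGroup.S) 0 0 = x 0 1 := by
        simp [ModularGroup.coe_S, Matrix.mul_apply, Fin.sum_univ_two]
      have h1 : (x * ModularGroup.S) 0 1 = -x 0 0 := by
        simp [ModularGroup.coe_S, Matrix.mul_apply, Fin.sum_univ_two]
      rw [h0, h1, SlashAction.slash_mul]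
      have := epsilon2UHP_slash_S_slash_S
      have := epsilon2UHP_slash_T_slash_S
      grind
    · have h0 : (x * ModularGroup.T) 0 0 = x 0 0 := by
        simp [ModularGroup.coe_T, Matrix.mul_apply, Fin.sum_univ_two]
      have h1 : (x * ModularGroup.T) 0 1 = x 0 0 + x 0 1 := by
        simp [ModularGroup.coe_T, Matrix.mul_apply, Fin.sum_univ_two]
      rw [h0, h1, SlashAction.slash_mul]
      have := epsilon2UHP_slash_T_slash_T
      have := epsilon2UHP_slash_S_slash_T
      grind
  | mul_inv_cancel x hx y hy ih =>
    have hx := hdet x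
    rcases hy with rfl | rfl
    · have h0 : (x * ModularGroup.S⁻¹) 0 0 = -x 0 1 := by
        simp [ModularGroup.coe_S, Matrix.mul_apply, Fin.sum_univ_two,
          Matrix.SpecialLinearGroup.coe_inv, Matrix.adjugate_fin_two]
      have h1 : (x * ModularGroup.S⁻¹) 0 1 = x 0 0 := by
        simp [ModularGroup.coe_S, Matrix.mul_apply, Fin.sum_univ_two,
          Matrix.SpecialLinearGroup.coe_inv, Matrix.adjugate_fin_two]
      rw [h0, h1, SlashAction.slash_mul]
      have := eq_slash_inv epsilon2UHP_slash_S_slash_S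
      have := eq_slash_inv epsilon2UHP_slash_T_slash_S
      have := eq_slash_inv (f := epsilon2UHP) (γ := ModularGroup.S) rfl
      grind
    · have h0 : (x * ModularGroup.T⁻¹) 0 0 = x 0 0 := by
        simp [ModularGroup.coe_T, Matrix.mul_apply, Fin.sum_univ_two,
          Matrix.SpecialLinearGroup.coe_inv, Matrix.adjugate_fin_two]
      have h1 : (x * ModularGroup.T⁻¹) 0 1 = -x 0 0 + x 0 1 := by
        simp [ModularGroup.coe_T, Matrix.mul_apply, Fin.sum_univ_two,
          Matrix.SpecialLinearGroup.coe_inv, Matrix.adjugate_fin_two]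
      rw [h0, h1, SlashAction.slash_mul]
      have := eq_slash_inv epsilon2UHP_slash_T_slash_T
      have := eq_slash_inv epsilon2UHP_slash_S_slash_T
      have := eq_slash_inv (f := epsilon2UHP) (γ := ModularGroup.T) rfl
      grind

lemma isBoundedAtImInfty_of_continuousAt_nome {f : ℍ → ℂ} {g : ℂ → ℂ} (hg : ContinuousAt g 0)
    (h : ∀ τ : ℍ, f τ = g (nome τ)) : IsBoundedAtImInfty f := by
  have hnome : Tendsto (fun τ : ℍ ↦ nome τ) atImInfty (𝓝 0) := by
    rw [tendsto_zero_iff_norm_tendsto_zero]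
    simp only [norm_nome]
    exact Real.tendsto_exp_neg_atTop_nhds_zero.comp
      (tendsto_comap.const_mul_atTop Real.pi_pos)
  rw [funext h]
  exact (hg.tendsto.comp hnome).isBigO_one ℝ

lemma continuousAt_eulerProd_pow {k : ℕ} (hk : k ≠ 0) :
    ContinuousAt (fun q ↦ eulerProd (q ^ k)) 0 :=
  ContinuousAt.comp (g := eulerProd)
    (by simpa [zero_pow hk] using continuousAt_eulerProd_zero) (by fun_prop)

lemma continuousAt_epsilon2_nome :
    ContinuousAt (fun q ↦ q * eulerProd (q ^ 2) ^ 16 / eulerProd q ^ 8) 0 :=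
  (continuousAt_id.mul ((continuousAt_eulerProd_pow two_ne_zero).pow 16)).div
    (continuousAt_eulerProd_zero.pow 8) (by simp [eulerProd_zero])

lemma isBoundedAtImInfty_epsilon2UHP : IsBoundedAtImInfty epsilon2UHP :=
  isBoundedAtImInfty_of_continuousAt_nome continuousAt_epsilon2_nome
    fun τ ↦ epsilon2_eq_eulerProd τ.im_pos

lemma isBoundedAtImInfty_epsilon2UHP_slash_S :
    IsBoundedAtImInfty (epsilon2UHP ∣[(4 : ℤ)] ModularGroup.S) := by
  refine isBoundedAtImInfty_of_continuousAt_nome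
    (g := fun q ↦ eulerProd (q ^ 2) ^ 16 / eulerProd (q ^ 4) ^ 8 / 16) ?_ fun τ ↦ ?_
  · exact (((continuousAt_eulerProd_pow two_ne_zero).pow 16).div
      ((continuousAt_eulerProd_pow four_ne_zero).pow 8) (by simp [eulerProd_zero])).div_const 16
  · rw [epsilon2UHP_slash_S_apply, ← pow_mul]

lemma isBoundedAtImInfty_epsilon2UHP_slash_T :
    IsBoundedAtImInfty (epsilon2UHP ∣[(4 : ℤ)] ModularGroup.T) := by
  have h := isBoundedAtImInfty_epsilon2UHP
  rw [isBoundedAtImInfty_iff] at h ⊢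
  obtain ⟨M, A, h⟩ := h
  refine ⟨M, A, fun τ hτ ↦ ?_⟩
  rw [slash_T_apply]
  exact h _ (by simpa using hτ)

lemma isBoundedAtImInfty_epsilon2UHP_slash (γ : SL(2, ℤ)) :
    IsBoundedAtImInfty (epsilon2UHP ∣[(4 : ℤ)] γ) := by
  obtain ⟨h0, h1, h2⟩ := epsilon2UHP_slash γ
  rcases Int.even_or_odd (γ 0 1) with hb | hb
  · rw [h0 hb]
    exact isBoundedAtImInfty_epsilon2UHP
  rcases Int.even_or_odd (γ 0 0) with ha | ha
  · rw [h1 ha]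
    exact isBoundedAtImInfty_epsilon2UHP_slash_S
  · rw [h2 ha hb]
    exact isBoundedAtImInfty_epsilon2UHP_slash_T

end

/-- `ε₂` is a modular form of weight 4 over `Γ⁰(2)` (matrices of `SL(2,ℤ)` with upper-right
entry even) with trivial character: it is holomorphic on the upper half-plane, transforms with
weight 4 under `Γ⁰(2)`, and all its weight-4 slash translates are bounded as `Im τ → ∞`. -/
theorem epsilon2_modularForm_weight_four_GammaUpper0_two :
    DifferentiableOn ℂ epsilon2 {τ : ℂ | 0 < τ.im} ∧
    (∀ γ : Matrix.SpecialLinearGroup (Fin 2) ℤ, (γ 0 1 : ZMod 2) = 0 →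
      ∀ τ : ℂ, 0 < τ.im →
        epsilon2 (((γ 0 0 : ℂ) * τ + (γ 0 1 : ℂ)) / ((γ 1 0 : ℂ) * τ + (γ 1 1 : ℂ))) =
          ((γ 1 0 : ℂ) * τ + (γ 1 1 : ℂ)) ^ 4 * epsilon2 τ) ∧
    (∀ γ : Matrix.SpecialLinearGroup (Fin 2) ℤ, ∃ C A : ℝ, ∀ τ : ℂ, A ≤ τ.im →
      ‖(((γ 1 0 : ℂ) * τ + (γ 1 1 : ℂ)) ^ 4)⁻¹ *
        epsilon2 (((γ 0 0 : ℂ) * τ + (γ 0 1 : ℂ)) / ((γ 1 0 : ℂ) * τ + (γ 1 1 : ℂ)))‖ ≤ C) := by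
  refine ⟨differentiableOn_epsilon2, fun γ hγ τ hτ ↦ ?_, fun γ ↦ ?_⟩
  · have hb : Even (γ 0 1) :=
      even_iff_two_dvd.mpr ((ZMod.intCast_zmod_eq_zero_iff_dvd _ 2).mp hγ)
    have h := congrFun ((epsilon2UHP_slash γ).1 hb) ⟨τ, hτ⟩
    have hd : (γ 1 0 : ℂ) * τ + (γ 1 1 : ℂ) ≠ 0 := by
      rw [← ModularGroup.denom_apply γ ⟨τ, hτ⟩]
      exact UpperHalfPlane.denom_ne_zero _ _
    rw [epsilon2UHP_slash_apply, inv_mul_eq_iff_eq_mul₀ (pow_ne_zero 4 hd)] at h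
    exact h
  · obtain ⟨M, A, h⟩ := UpperHalfPlane.isBoundedAtImInfty_iff.mp
      (isBoundedAtImInfty_epsilon2UHP_slash γ)
    refine ⟨M, max A 1, fun τ hτ ↦ ?_⟩
    have hpos : 0 < τ.im := one_pos.trans_le ((le_max_right A 1).trans hτ)
    simpa only [epsilon2UHP_slash_apply] using h ⟨τ, hpos⟩ ((le_max_left A 1).trans hτ)
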